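/- arXiv:1806.04701 — 2 statements merged into one kernel-verified Lean document; each statement's English description precedes it below -/
import Mathlib

section
/- Let 0 < a < 1 < b and δ > 0. Then liminf_{n→∞, n even} (1/n²) ln ∫_{Σ_{n,a,b,δ}} Z_n^{−1} |Δ(μ)|² e^{−Σ_{j=1}^{n/2} μ_j²/2} dμ ≥ 0. -/
open MeasureTheory

noncomputable section

/-- The open Weyl chamber `Σ_n`: strictly decreasing positive vectors. -/
def SigmaN (m : ℕ) : Set (Fin m → ℝ) :=
  {μ | (∀ i j : Fin m, i < j → μ j < μ i) ∧ ∀ i, 0 < μ i}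

/-- The Vandermonde-type determinant `Δ(μ) = ∏_{i<j} (μ_i² − μ_j²)`. -/
def VdM (m : ℕ) (μ : Fin m → ℝ) : ℝ :=
  ∏ p ∈ Finset.univ.filter (fun p : Fin m × Fin m => p.1 < p.2), (μ p.1 ^ 2 - μ p.2 ^ 2)

/-- The normalization constant `Z_n = (π/2)^{n/4} ∏_{j=0}^{n/2−1} (2j)!`. -/
def Zn (n : ℕ) : ℝ :=
  (Real.pi / 2) ^ ((n : ℝ) / 4) * ∏ j ∈ Finset.range (n / 2), (Nat.factorial (2 * j) : ℝ)


/-- The set `Σ_{n,a,b,δ} = Σ_{n,a,b} \ Σ_{n,>δ}`; on `Σ_n` the largest coordinate is `μ_1`,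
so the condition `μ_1² ≤ δ·C(n,2)` is expressed as `∀ i, μ i ^ 2 ≤ δ·C(n,2)`. -/
def SigABD (n : ℕ) (a b δ : ℝ) : Set (Fin (n / 2) → ℝ) :=
  {μ | μ ∈ SigmaN (n / 2) ∧
    (a * (n.choose 2 : ℝ) < ∑ j, μ j ^ 2 ∧ ∑ j, μ j ^ 2 < b * (n.choose 2 : ℝ)) ∧
    ∀ i, μ i ^ 2 ≤ δ * (n.choose 2 : ℝ)}


open Polynomial in
theorem integrable_eval_mul_gaussian (p : ℝ[X]) :
    Integrable (fun x : ℝ => p.eval x * Real.exp (-(x ^ 2 / 2))) := by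
  induction p using Polynomial.induction_on' with
  | add p q hp hq => simpa [add_mul] using! hp.add hq
  | monomial n c =>
    have h := integrable_rpow_mul_exp_neg_mul_sq (b := 1 / 2) (by norm_num) (s := n)
      (by linarith [(Nat.cast_nonneg n : (0 : ℝ) ≤ n)])
    refine (h.const_mul c).congr (Filter.Eventually.of_forall fun x => ?_)
    simp only [Polynomial.eval_monomial, Real.rpow_natCast, mul_assoc]
    congr 3
    ring

theorem integral_gaussian_half : ∫ x : ℝ, Real.exp (-(x ^ 2 / 2)) = √(2 * Real.pi) := by
  have h := integral_gaussian (1 / 2)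
  rw [show Real.pi / (1 / 2) = 2 * Real.pi by ring] at h
  rw [← h]
  congr 1 with x
  congr 1
  ring

/-- Iterated integration by parts against the Gaussian weight. -/
theorem integral_eval_mul_hermite (p : Polynomial ℝ) (n : ℕ) :
    ∫ x : ℝ, p.eval x * Polynomial.aeval x (Polynomial.hermite n) * Real.exp (-(x ^ 2 / 2)) =
      ∫ x : ℝ, (Polynomial.derivative^[n] p).eval x * Real.exp (-(x ^ 2 / 2)) := by
  induction n generalizing p with
  | zero => simp
  | succ n ih =>
    rw [Function.iterate_succ_apply, ← ih]
    set H : Polynomial ℝ := (Polynomial.hermite n).map (algebraMap ℤ ℝ) with hH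
    have hH' : ∀ x : ℝ, Polynomial.aeval x (Polynomial.hermite n) = H.eval x := fun x => by
      rw [hH, Polynomial.eval_map_algebraMap]
    have hHs : ∀ x : ℝ, Polynomial.aeval x (Polynomial.hermite (n + 1)) =
        x * H.eval x - H.derivative.eval x := fun x => by
      rw [hH, Polynomial.derivative_map, Polynomial.eval_map_algebraMap,
        Polynomial.eval_map_algebraMap]
      simp [Polynomial.hermite_succ]
    have hu : ∀ x : ℝ, HasDerivAt (fun x => p.eval x) (p.derivative.eval x) x :=
      fun x => p.hasDerivAt x
    have hg : ∀ x : ℝ, HasDerivAt (fun x : ℝ => Real.exp (-(x ^ 2 / 2)))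
        (-x * Real.exp (-(x ^ 2 / 2))) x := fun x => by
      have h1 : HasDerivAt (fun x : ℝ => -(x ^ 2 / 2)) (-x) x := by
        have := ((hasDerivAt_pow 2 x).div_const 2).neg
        simpa using! this
      simpa [mul_comm] using h1.exp
    have hv : ∀ x : ℝ, HasDerivAt (fun x : ℝ => H.eval x * Real.exp (-(x ^ 2 / 2)))
        (-((x * H.eval x - H.derivative.eval x) * Real.exp (-(x ^ 2 / 2)))) x := fun x => by
      refine ((H.hasDerivAt x).mul (hg x)).congr_deriv ?_
      ring
    have key := integral_mul_deriv_eq_deriv_mul_of_integrable (fun x _ => hu x) (fun x _ => hv x)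
      ?_ ?_ ?_
    · simp only [hH', hHs]
      have e1 : ∀ x : ℝ, p.eval x * (x * H.eval x - H.derivative.eval x) *
          Real.exp (-(x ^ 2 / 2)) = -(p.eval x *
          -((x * H.eval x - H.derivative.eval x) * Real.exp (-(x ^ 2 / 2)))) := fun x => by ring
      simp_rw [e1, integral_neg, key, neg_neg, mul_assoc]
    · refine (integrable_eval_mul_gaussian
        (-(p * (Polynomial.X * H - H.derivative)))).congr (Filter.Eventually.of_forall fun x => ?_)
      simp
      ring
    · refine (integrable_eval_mul_gaussian (p.derivative * H)).congr
        (Filter.Eventually.of_forall fun x => ?_)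
      simp
      ring
    · refine (integrable_eval_mul_gaussian (p * H)).congr
        (Filter.Eventually.of_forall fun x => ?_)
      simp
      ring

/-- Orthogonality of the Hermite polynomials. -/
theorem integral_hermite_mul_hermite (k n : ℕ) :
    ∫ x : ℝ, Polynomial.aeval x (Polynomial.hermite k) *
      Polynomial.aeval x (Polynomial.hermite n) * Real.exp (-(x ^ 2 / 2)) =
      if k = n then (n.factorial : ℝ) * √(2 * Real.pi) else 0 := by
  wlog hkn : k ≤ n generalizing k n
  · have h := this n k (by omega)
    simp_rw [mul_comm (Polynomial.aeval _ (Polynomial.hermite k))]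
    rw [h]
    by_cases e : k = n
    · subst e; rfl
    · rw [if_neg e, if_neg (Ne.symm e)]
  set P : Polynomial ℝ := (Polynomial.hermite k).map (algebraMap ℤ ℝ) with hP
  have hP' : ∀ x : ℝ, Polynomial.aeval x (Polynomial.hermite k) = P.eval x := fun x => by
    rw [hP, Polynomial.eval_map_algebraMap]
  have hdeg : P.natDegree = k := by
    rw [hP, (Polynomial.hermite_monic k).natDegree_map, Polynomial.natDegree_hermite]
  simp_rw [hP', integral_eval_mul_hermite]
  split_ifs with e
  · subst e
    have hd : Polynomial.derivative^[k] P = Polynomial.C (k.factorial : ℝ) := by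
      have h0 : (Polynomial.derivative^[k] P).natDegree = 0 := by
        have := Polynomial.natDegree_iterate_derivative P k
        omega
      rw [Polynomial.eq_C_of_natDegree_eq_zero h0, Polynomial.coeff_iterate_derivative]
      simp [hP, Nat.descFactorial_self]
    simp_rw [hd, Polynomial.eval_C, integral_const_mul, integral_gaussian_half]
  · have hd : Polynomial.derivative^[n] P = 0 :=
      Polynomial.iterate_derivative_eq_zero (by omega)
    simp [hd]

theorem VdM_eq_prod_Ioi (k : ℕ) (x : Fin k → ℝ) :
    VdM k x = ∏ i, ∏ j ∈ Finset.Ioi i, (x i ^ 2 - x j ^ 2) := by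
  rw [VdM, Finset.prod_filter, ← Finset.univ_product_univ, Finset.prod_product]
  refine Finset.prod_congr rfl fun i _ => ?_
  rw [← Finset.prod_filter]
  refine Finset.prod_congr ?_ fun _ _ => rfl
  ext j
  simp

theorem VdM_sq_eq_det_vandermonde_sq (k : ℕ) (x : Fin k → ℝ) :
    VdM k x ^ 2 = (Matrix.vandermonde fun i => x i ^ 2).det ^ 2 := by
  rw [Matrix.det_vandermonde, VdM_eq_prod_Ioi, ← Finset.prod_pow, ← Finset.prod_pow]
  refine Finset.prod_congr rfl fun i _ => ?_
  rw [← Finset.prod_pow, ← Finset.prod_pow]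
  exact Finset.prod_congr rfl fun j _ => by ring

theorem VdM_sq_signed_perm (k : ℕ) (ε : Fin k → ℤˣ) (σ : Equiv.Perm (Fin k)) (x : Fin k → ℝ) :
    VdM k (fun i => ((ε i : ℤ) : ℝ) * x (σ i)) ^ 2 = VdM k x ^ 2 := by
  have hsq : ∀ i, (((ε i : ℤ) : ℝ) * x (σ i)) ^ 2 = x (σ i) ^ 2 := fun i => by
    rcases Int.units_eq_one_or (ε i) with h | h <;> simp [h]
  rw [VdM_sq_eq_det_vandermonde_sq, VdM_sq_eq_det_vandermonde_sq]
  simp_rw [hsq]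
  have h : (Matrix.vandermonde fun i => x (σ i) ^ 2) =
      (Matrix.vandermonde fun i => x i ^ 2).submatrix σ id := rfl
  rw [h, Matrix.det_permute, mul_pow]
  rcases Int.units_eq_one_or (Equiv.Perm.sign σ) with h | h <;> simp [h]

theorem VdM_eq_zero_of_sq_eq (k : ℕ) (x : Fin k → ℝ) {i j : Fin k} (hij : i ≠ j)
    (h : x i ^ 2 = x j ^ 2) : VdM k x = 0 := by
  rcases lt_or_gt_of_ne hij with hlt | hlt
  · exact Finset.prod_eq_zero (i := (i, j)) (by simpa using hlt) (by simp [h])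
  · exact Finset.prod_eq_zero (i := (j, i)) (by simpa using hlt) (by simp [h])

theorem VdM_smul_sq (k : ℕ) (r : ℝ) (x : Fin k → ℝ) :
    VdM k (r • x) ^ 2 = (r ^ 2) ^ (k * (k - 1)) * VdM k x ^ 2 := by
  have hc : (∑ i : Fin k, (k - 1 - (i : ℕ))) * 2 = k * (k - 1) := by
    rw [Fin.sum_univ_eq_sum_range fun i => k - 1 - i, Finset.sum_range_reflect (fun i => i),
      Finset.sum_range_id_mul_two]
  have h : VdM k (r • x) = (r ^ 2) ^ (∑ i : Fin k, (k - 1 - (i : ℕ))) * VdM k x := by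
    rw [VdM_eq_prod_Ioi, VdM_eq_prod_Ioi, ← Finset.prod_pow_eq_pow_sum, ← Finset.prod_mul_distrib]
    refine Finset.prod_congr rfl fun i _ => ?_
    rw [← Fin.card_Ioi, ← Finset.prod_const, ← Finset.prod_mul_distrib]
    refine Finset.prod_congr rfl fun j _ => ?_
    simp only [Pi.smul_apply, smul_eq_mul]
    ring
  rw [h, mul_pow, ← pow_mul, hc]

theorem VdM_cons (k : ℕ) (t : ℝ) (y : Fin k → ℝ) :
    VdM (k + 1) (Fin.cons t y) = (∏ j, (t ^ 2 - y j ^ 2)) * VdM k y := by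
  simp [VdM_eq_prod_Ioi, Fin.prod_univ_succ, Fin.prod_Ioi_succ]

/-- The monic polynomial `p` of degree `j` with `p (x ^ 2) = hermite (2 * j) x`. -/
def evenHermite (j : ℕ) : Polynomial ℝ :=
  Polynomial.contract 2 ((Polynomial.hermite (2 * j)).map (algebraMap ℤ ℝ))

theorem coeff_evenHermite (j i : ℕ) :
    (evenHermite j).coeff i = ((Polynomial.hermite (2 * j)).coeff (i * 2) : ℝ) := by
  simp [evenHermite, Polynomial.coeff_contract]

theorem natDegree_evenHermite (j : ℕ) : (evenHermite j).natDegree = j := by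
  refine Polynomial.natDegree_eq_of_le_of_coeff_ne_zero ?_ ?_
  · refine Polynomial.natDegree_le_iff_coeff_eq_zero.2 fun i hi => ?_
    rw [coeff_evenHermite, Polynomial.coeff_hermite_of_lt (by omega), Int.cast_zero]
  · rw [coeff_evenHermite, mul_comm j 2, Polynomial.coeff_hermite_self]
    simp

theorem monic_evenHermite (j : ℕ) : (evenHermite j).Monic := by
  rw [Polynomial.Monic, Polynomial.leadingCoeff, natDegree_evenHermite, coeff_evenHermite,
    mul_comm j 2, Polynomial.coeff_hermite_self, Int.cast_one]

theorem eval_evenHermite_sq (j : ℕ) (x : ℝ) :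
    (evenHermite j).eval (x ^ 2) = Polynomial.aeval x (Polynomial.hermite (2 * j)) := by
  have h : Polynomial.expand ℝ 2 (evenHermite j) =
      (Polynomial.hermite (2 * j)).map (algebraMap ℤ ℝ) := by
    ext i
    rw [Polynomial.coeff_expand two_pos, Polynomial.coeff_map]
    split_ifs with hi
    · rw [coeff_evenHermite, Nat.div_mul_cancel hi]
      rfl
    · rw [Polynomial.coeff_hermite_of_odd_add, map_zero]
      rw [Nat.odd_add, ← Nat.not_even_iff_odd]
      simp [even_iff_two_dvd, hi]
  rw [← Polynomial.expand_eval, h, Polynomial.eval_map_algebraMap]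

theorem VdM_sq_eq_det_hermite_sq (k : ℕ) (x : Fin k → ℝ) :
    VdM k x ^ 2 = (Matrix.of fun i j : Fin k =>
      (Polynomial.aeval (x i) (Polynomial.hermite (2 * j)) : ℝ)).det ^ 2 := by
  rw [VdM_sq_eq_det_vandermonde_sq, Matrix.det_eval_matrixOfPolynomials_eq_det_vandermonde _
    (fun j : Fin k => evenHermite j) (fun j => natDegree_evenHermite j)
    (fun j => monic_evenHermite j)]
  simp_rw [eval_evenHermite_sq]

/-- The unnormalized density `|Δ(x)|² exp(-∑ x_j² / 2)` on the whole space. -/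
def weight (k : ℕ) (x : Fin k → ℝ) : ℝ :=
  VdM k x ^ 2 * Real.exp (-(∑ j, x j ^ 2) / 2)

theorem weight_nonneg (k : ℕ) (x : Fin k → ℝ) : 0 ≤ weight k x := by
  unfold weight; positivity

/-- Leibniz expansion of `weight` through the squared Hermite determinant. -/
theorem weight_eq_sum (k : ℕ) (x : Fin k → ℝ) :
    weight k x = ∑ σ : Equiv.Perm (Fin k), ∑ τ : Equiv.Perm (Fin k),
      ((Equiv.Perm.sign σ : ℤ) : ℝ) * ((Equiv.Perm.sign τ : ℤ) : ℝ) *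
      ∏ i, (Polynomial.aeval (x i) (Polynomial.hermite (2 * (σ i : ℕ))) *
        Polynomial.aeval (x i) (Polynomial.hermite (2 * (τ i : ℕ))) *
        Real.exp (-(x i ^ 2 / 2))) := by
  have he : Real.exp (-(∑ j, x j ^ 2) / 2) = ∏ i, Real.exp (-(x i ^ 2 / 2)) := by
    rw [← Real.exp_sum, Finset.sum_neg_distrib, ← Finset.sum_div, neg_div]
  rw [weight, VdM_sq_eq_det_hermite_sq, ← Matrix.det_transpose, Matrix.det_apply', sq,
    Finset.sum_mul_sum, Finset.sum_mul, he]
  refine Finset.sum_congr rfl fun σ _ => ?_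
  rw [Finset.sum_mul]
  refine Finset.sum_congr rfl fun τ _ => ?_
  simp only [Matrix.transpose_apply, Matrix.of_apply, Finset.prod_mul_distrib]
  ring

theorem integrable_prod_hermite (k : ℕ) (σ τ : Equiv.Perm (Fin k)) :
    Integrable fun x : Fin k → ℝ =>
      ∏ i, (Polynomial.aeval (x i) (Polynomial.hermite (2 * (σ i : ℕ))) *
        Polynomial.aeval (x i) (Polynomial.hermite (2 * (τ i : ℕ))) *
        Real.exp (-(x i ^ 2 / 2))) := by
  refine Integrable.fintype_prod (f := fun (i : Fin k) (t : ℝ) =>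
    (Polynomial.aeval t (Polynomial.hermite (2 * (σ i : ℕ))) *
        Polynomial.aeval t (Polynomial.hermite (2 * (τ i : ℕ))) *
        Real.exp (-(t ^ 2 / 2)) : ℝ)) fun i => ?_
  refine (integrable_eval_mul_gaussian
    (((Polynomial.hermite (2 * (σ i : ℕ))) * (Polynomial.hermite (2 * (τ i : ℕ)))).map
      (algebraMap ℤ ℝ))).congr (Filter.Eventually.of_forall fun t => ?_)
  simp only [Polynomial.eval_map_algebraMap, map_mul]

theorem integrable_weight (k : ℕ) : Integrable (weight k) := by
  have h : weight k = _ := funext (weight_eq_sum k)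
  rw [h]
  exact integrable_finsetSum _ fun σ _ => integrable_finsetSum _ fun τ _ =>
    (integrable_prod_hermite k σ τ).const_mul _

theorem integral_weight (k : ℕ) :
    ∫ x, weight k x = k.factorial * ∏ j ∈ Finset.range k,
      (((2 * j).factorial : ℝ) * √(2 * Real.pi)) := by
  simp_rw [weight_eq_sum]
  rw [integral_finsetSum _ fun σ _ => integrable_finsetSum _ fun τ _ =>
    (integrable_prod_hermite k σ τ).const_mul _]
  have hσ : ∀ σ : Equiv.Perm (Fin k), (∫ x : Fin k → ℝ, ∑ τ : Equiv.Perm (Fin k),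
      ((Equiv.Perm.sign σ : ℤ) : ℝ) * ((Equiv.Perm.sign τ : ℤ) : ℝ) *
      ∏ i, (Polynomial.aeval (x i) (Polynomial.hermite (2 * (σ i : ℕ))) *
        Polynomial.aeval (x i) (Polynomial.hermite (2 * (τ i : ℕ))) *
        Real.exp (-(x i ^ 2 / 2)))) =
      ∏ j ∈ Finset.range k, (((2 * j).factorial : ℝ) * √(2 * Real.pi)) := fun σ => by
    rw [integral_finsetSum _ fun τ _ => (integrable_prod_hermite k σ τ).const_mul _]
    have hint : ∀ τ : Equiv.Perm (Fin k), (∫ x : Fin k → ℝ,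
        ∏ i, (Polynomial.aeval (x i) (Polynomial.hermite (2 * (σ i : ℕ))) *
        Polynomial.aeval (x i) (Polynomial.hermite (2 * (τ i : ℕ))) *
        Real.exp (-(x i ^ 2 / 2)))) = ∏ i, if 2 * (σ i : ℕ) = 2 * (τ i : ℕ) then
          ((2 * (τ i : ℕ)).factorial : ℝ) * √(2 * Real.pi) else 0 := fun τ => by
      rw [integral_fintype_prod_volume_eq_prod (fun (i : Fin k) (t : ℝ) =>
        (Polynomial.aeval t (Polynomial.hermite (2 * (σ i : ℕ))) *
        Polynomial.aeval t (Polynomial.hermite (2 * (τ i : ℕ))) *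
        Real.exp (-(t ^ 2 / 2)) : ℝ))]
      exact Finset.prod_congr rfl fun i _ => integral_hermite_mul_hermite _ _
    simp_rw [integral_const_mul, hint]
    rw [Finset.sum_eq_single σ]
    · rw [← Int.cast_mul, ← Units.val_mul, Int.units_mul_self]
      simp only [if_true, Units.val_one, Int.cast_one, one_mul]
      rw [Equiv.prod_comp σ fun i : Fin k => ((2 * (i : ℕ)).factorial : ℝ) * √(2 * Real.pi),
        Fin.prod_univ_eq_prod_range fun i => ((2 * i).factorial : ℝ) * √(2 * Real.pi)]
    · intro τ _ hne
      obtain ⟨i, hi⟩ : ∃ i, σ i ≠ τ i := by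
        by_contra hcon
        push Not at hcon
        exact hne (Equiv.ext fun i => (hcon i).symm)
      rw [Finset.prod_eq_zero (Finset.mem_univ i), mul_zero]
      exact if_neg fun h => hi (Fin.ext (by omega))
    · simp
  simp_rw [hσ]
  simp [Fintype.card_perm]

theorem measurePreserving_signed_perm (k : ℕ) (ε : Fin k → ℤˣ) (σ : Equiv.Perm (Fin k)) :
    MeasurePreserving (fun (x : Fin k → ℝ) i => ((ε i : ℤ) : ℝ) * x (σ i)) := by
  have h1 : MeasurePreserving (fun (x : Fin k → ℝ) i => x (σ i)) := by
    convert! volume_measurePreserving_piCongrLeft (fun _ : Fin k => ℝ) σ.symm using 1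
    ext x i
    have := MeasurableEquiv.piCongrLeft_apply_apply (β := fun _ : Fin k => ℝ) σ.symm x (σ i)
    simpa using this.symm
  have h2 : MeasurePreserving (fun (x : Fin k → ℝ) i => ((ε i : ℤ) : ℝ) * x i) := by
    refine volume_preserving_pi (f := fun i t => ((ε i : ℤ) : ℝ) * t) fun i => ?_
    rcases Int.units_eq_one_or (ε i) with h | h
    · simpa [h] using! MeasurePreserving.id (volume : Measure ℝ)
    · simpa [h] using! Measure.measurePreserving_neg (volume : Measure ℝ)
  exact h2.comp h1

theorem measurableSet_SigmaN (k : ℕ) : MeasurableSet (SigmaN k) := by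
  have h : SigmaN k = (⋂ i, ⋂ j, ⋂ (_ : i < j), {x : Fin k → ℝ | x j < x i}) ∩
      ⋂ i, {x : Fin k → ℝ | 0 < x i} := by
    ext x
    simp [SigmaN]
  rw [h]
  exact (MeasurableSet.iInter fun i => MeasurableSet.iInter fun j => MeasurableSet.iInter fun _ =>
    measurableSet_lt (measurable_pi_apply j) (measurable_pi_apply i)).inter
    (MeasurableSet.iInter fun i => measurableSet_lt measurable_const (measurable_pi_apply i))

/-- A vector with nonzero coordinates of distinct absolute values is moved into the open Weyl
chamber by some signed permutation. -/
theorem exists_signed_perm_mem_SigmaN (k : ℕ) (x : Fin k → ℝ) (h0 : ∀ i, x i ≠ 0)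
    (hinj : ∀ i j, i ≠ j → x i ^ 2 ≠ x j ^ 2) :
    ∃ (ε : Fin k → ℤˣ) (σ : Equiv.Perm (Fin k)),
      (fun i => ((ε i : ℤ) : ℝ) * x (σ i)) ∈ SigmaN k := by
  set σ := Tuple.sort fun i => -|x i| with hσ
  have hmono := Tuple.monotone_sort fun i => -|x i|
  refine ⟨fun i => if 0 < x (σ i) then 1 else -1, σ, ?_⟩
  have habs : ∀ i, ((((if 0 < x (σ i) then 1 else -1 : ℤˣ) : ℤ)) : ℝ) * x (σ i) = |x (σ i)| := by
    intro i
    split_ifs with h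
    · simp [abs_of_pos h]
    · simp [abs_of_nonpos (not_lt.1 h)]
  simp only [habs]
  refine ⟨fun i j hij => lt_of_le_of_ne ?_ ?_, fun i => abs_pos.2 (h0 _)⟩
  · have := hmono hij.le
    simpa [← hσ] using this
  · intro h
    exact hinj _ _ (fun e => hij.ne' (σ.injective e)) ((sq_eq_sq_iff_abs_eq_abs _ _).2 h)

theorem integral_le_card_mul_integral {α ι : Type*} [MeasurableSpace α] [Fintype ι]
    {μ : Measure α} (T : ι → α → α) (hT : ∀ p, MeasurePreserving (T p) μ μ) {h g : α → ℝ}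
    (hh : Integrable h μ) (hg : Integrable g μ) (hle : h ≤ᵐ[μ] fun x => ∑ p, g (T p x)) :
    ∫ x, h x ∂μ ≤ Fintype.card ι * ∫ x, g x ∂μ := by
  have hcomp : ∀ p, Integrable (fun x => g (T p x)) μ := fun p =>
    (hT p).integrable_comp_of_integrable hg
  have hval : ∀ p, ∫ x, g (T p x) ∂μ = ∫ x, g x ∂μ := fun p => by
    have := integral_map (hT p).measurable.aemeasurable (f := g)
      (by rw [(hT p).map_eq]; exact hg.aestronglyMeasurable)
    rw [(hT p).map_eq] at this
    exact this.symm
  refine (integral_mono_ae hh (integrable_finsetSum _ fun p _ => hcomp p) hle).trans_eq ?_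
  rw [integral_finsetSum _ fun p _ => hcomp p]
  simp [hval]

theorem integral_le_mul_setIntegral_SigmaN (k : ℕ) (h : (Fin k → ℝ) → ℝ) (hint : Integrable h)
    (hnn : ∀ x, 0 ≤ h x)
    (hinv : ∀ (ε : Fin k → ℤˣ) (σ : Equiv.Perm (Fin k)) x,
      h (fun i => ((ε i : ℤ) : ℝ) * x (σ i)) = h x)
    (hzero : ∀ x i j, i ≠ j → x i ^ 2 = x j ^ 2 → h x = 0) :
    ∫ x, h x ≤ 2 ^ k * k.factorial * ∫ x in SigmaN k, h x := by
  have hgnn : ∀ x, 0 ≤ (SigmaN k).indicator h x :=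
    fun x => Set.indicator_nonneg (fun x _ => hnn x) x
  have hae : ∀ᵐ x : Fin k → ℝ, ∀ i, x i ≠ 0 := by
    rw [ae_all_iff]
    intro i
    have := Measure.pi_hyperplane (fun _ : Fin k => (volume : Measure ℝ)) i 0
    rw [ae_iff]
    simpa [volume_pi] using this
  have key := integral_le_card_mul_integral
    (fun (p : (Fin k → ℤˣ) × Equiv.Perm (Fin k)) (x : Fin k → ℝ) i =>
      ((p.1 i : ℤ) : ℝ) * x (p.2 i)) (fun p => measurePreserving_signed_perm k p.1 p.2)
    hint (hint.indicator (measurableSet_SigmaN k)) ?_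
  · rw [integral_indicator (measurableSet_SigmaN k)] at key
    refine key.trans_eq ?_
    congr 1
    rw [Fintype.card_prod, Fintype.card_pi_const, Fintype.card_perm, Fintype.card_fin,
      Fintype.card_units_int]
    push_cast
    ring
  · filter_upwards [hae] with x hx
    by_cases hinj : ∀ i j, i ≠ j → x i ^ 2 ≠ x j ^ 2
    · obtain ⟨ε, σ, hmem⟩ := exists_signed_perm_mem_SigmaN k x hx hinj
      refine le_trans (le_of_eq ?_) (Finset.single_le_sum (fun p _ => hgnn _)
        (Finset.mem_univ (ε, σ)))
      rw [Set.indicator_of_mem hmem, hinv]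
    · push Not at hinj
      obtain ⟨i, j, hij, he⟩ := hinj
      rw [hzero x i j hij he]
      exact Finset.sum_nonneg fun p _ => hgnn _

theorem weight_signed_perm (k : ℕ) (ε : Fin k → ℤˣ) (σ : Equiv.Perm (Fin k)) (x : Fin k → ℝ) :
    weight k (fun i => ((ε i : ℤ) : ℝ) * x (σ i)) = weight k x ∧
    ∑ i, (((ε i : ℤ) : ℝ) * x (σ i)) ^ 2 = ∑ i, x i ^ 2 := by
  have hsq : ∑ i, (((ε i : ℤ) : ℝ) * x (σ i)) ^ 2 = ∑ i, x i ^ 2 := by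
    rw [← Equiv.sum_comp σ fun i => x i ^ 2]
    refine Finset.sum_congr rfl fun i _ => ?_
    rcases Int.units_eq_one_or (ε i) with h | h <;> simp [h]
  exact ⟨by rw [weight, VdM_sq_signed_perm, hsq, weight], hsq⟩

/-- Restricting a shell to the open Weyl chamber loses at most the order `2 ^ k * k!` of the
hyperoctahedral group. -/
theorem setIntegral_shell_le (k : ℕ) (u v : ℝ) :
    ∫ x in {x : Fin k → ℝ | u < ∑ j, x j ^ 2 ∧ ∑ j, x j ^ 2 < v}, weight k x ≤
      2 ^ k * k.factorial *
        ∫ x in SigmaN k ∩ {x | u < ∑ j, x j ^ 2 ∧ ∑ j, x j ^ 2 < v}, weight k x := by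
  set G := {x : Fin k → ℝ | u < ∑ j, x j ^ 2 ∧ ∑ j, x j ^ 2 < v} with hG
  have hS : Measurable fun x : Fin k → ℝ => ∑ j, x j ^ 2 := by fun_prop
  have hGm : MeasurableSet G :=
    (measurableSet_lt measurable_const hS).inter (measurableSet_lt hS measurable_const)
  rw [← setIntegral_indicator hGm, ← integral_indicator hGm]
  refine integral_le_mul_setIntegral_SigmaN k _ ((integrable_weight k).indicator hGm)
    (fun x => Set.indicator_nonneg (fun x _ => weight_nonneg k x) x) (fun ε σ x => ?_)
    (fun x i j hij h => ?_)
  · obtain ⟨hw, hs⟩ := weight_signed_perm k ε σ x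
    simp only [Set.indicator, hG, Set.mem_ofPred_eq, hs, hw]
  · simp [Set.indicator, weight, VdM_eq_zero_of_sq_eq k x hij h]

theorem weight_sqrt_smul (k : ℕ) {s : ℝ} (hs : 0 < s) (x : Fin k → ℝ) :
    weight k (√s • x) = s ^ (k * (k - 1)) *
      (VdM k x ^ 2 * Real.exp (-(s * ∑ j, x j ^ 2) / 2)) := by
  have h : ∑ j, (√s • x) j ^ 2 = s * ∑ j, x j ^ 2 := by
    simp [mul_pow, Real.sq_sqrt hs.le, Finset.mul_sum]
  rw [weight, VdM_smul_sq, h, Real.sq_sqrt hs.le, mul_assoc]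

theorem integrable_VdM_sq_mul_exp (k : ℕ) {s : ℝ} (hs : 0 < s) :
    Integrable fun x : Fin k → ℝ => VdM k x ^ 2 * Real.exp (-(s * ∑ j, x j ^ 2) / 2) := by
  have h := ((integrable_weight k).comp_smul (Real.sqrt_pos.2 hs).ne').const_mul
    ((s ^ (k * (k - 1)))⁻¹)
  refine h.congr (Filter.Eventually.of_forall fun x => ?_)
  simp only [weight_sqrt_smul k hs]
  rw [inv_mul_cancel_left₀ (by positivity)]

/-- By homogeneity, `∑ x_j²` has the Laplace transform of a chi-squared variable with
`k * (2 * k - 1)` degrees of freedom. -/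
theorem integral_VdM_sq_mul_exp (k : ℕ) {s : ℝ} (hs : 0 < s) :
    ∫ x : Fin k → ℝ, VdM k x ^ 2 * Real.exp (-(s * ∑ j, x j ^ 2) / 2) =
      Real.exp (-((k * (2 * k - 1) : ℝ) / 2 * Real.log s)) * ∫ x, weight k x := by
  have h := Measure.integral_comp_smul_of_nonneg volume (weight k) √s (hR := Real.sqrt_nonneg s)
  simp_rw [weight_sqrt_smul k hs, integral_const_mul] at h
  rw [Module.finrank_pi, Fintype.card_fin, smul_eq_mul] at h
  have hsk : s ^ (k * (k - 1)) * √s ^ k = Real.exp ((k * (2 * k - 1) : ℝ) / 2 * Real.log s) := by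
    rw [← Real.rpow_natCast, ← Real.rpow_natCast, Real.sqrt_eq_rpow, ← Real.rpow_mul hs.le,
      ← Real.rpow_add hs, Real.rpow_def_of_pos hs]
    congr 1
    have : (((k * (k - 1) : ℕ)) : ℝ) = (k : ℝ) * (k - 1) := by
      cases k <;> simp
    rw [this]
    ring
  have hpos : 0 < s ^ (k * (k - 1)) := by positivity
  have hpos' : 0 < √s ^ k := by positivity
  rw [Real.exp_neg, ← hsk, mul_inv, mul_assoc, ← h, inv_mul_cancel_left₀ hpos.ne']

/-- Chernoff bound for `∑ x_j²`; the case `1 < c` bounds the upper tail and `c < 1` the lower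
tail. -/
theorem setIntegral_weight_chernoff (k : ℕ) {c : ℝ} (hc : 0 < c) {A : Set (Fin k → ℝ)}
    (hA : MeasurableSet A)
    (h : ∀ x ∈ A, (1 - c⁻¹) * (c * (k * (2 * k - 1))) ≤ (1 - c⁻¹) * ∑ j, x j ^ 2) :
    ∫ x in A, weight k x ≤
      Real.exp (-((k * (2 * k - 1) : ℝ) / 2 * (c - 1 - Real.log c))) * ∫ x, weight k x := by
  have hi := (integrable_VdM_sq_mul_exp k (inv_pos.2 hc)).const_mul
    (Real.exp (-((1 - c⁻¹) * (c * (k * (2 * k - 1)))) / 2))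
  calc ∫ x in A, weight k x
      ≤ ∫ x in A, Real.exp (-((1 - c⁻¹) * (c * (k * (2 * k - 1)))) / 2) *
          (VdM k x ^ 2 * Real.exp (-(c⁻¹ * ∑ j, x j ^ 2) / 2)) := by
        refine setIntegral_mono_on (integrable_weight k).integrableOn hi.integrableOn hA
          fun x hx => ?_
        rw [weight, mul_left_comm, ← Real.exp_add]
        refine mul_le_mul_of_nonneg_left (Real.exp_le_exp.2 ?_) (sq_nonneg _)
        have := h x hx
        linarith
    _ ≤ ∫ x, Real.exp (-((1 - c⁻¹) * (c * (k * (2 * k - 1)))) / 2) *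
          (VdM k x ^ 2 * Real.exp (-(c⁻¹ * ∑ j, x j ^ 2) / 2)) :=
        setIntegral_le_integral hi (Filter.Eventually.of_forall fun x => by
          simp only [Pi.zero_apply]; positivity)
    _ = Real.exp (-((k * (2 * k - 1) : ℝ) / 2 * (c - 1 - Real.log c))) * ∫ x, weight k x := by
        rw [integral_const_mul, integral_VdM_sq_mul_exp k (inv_pos.2 hc), ← mul_assoc,
          ← Real.exp_add, Real.log_inv]
        congr 2
        field_simp
        ring

theorem integrable_and_integral_head_mul_tail (k : ℕ) {f : ℝ → ℝ} {g : (Fin k → ℝ) → ℝ}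
    (hf : Integrable f) (hg : Integrable g) :
    Integrable (fun x : Fin (k + 1) → ℝ => f (x 0) * g (Fin.tail x)) ∧
    ∫ x : Fin (k + 1) → ℝ, f (x 0) * g (Fin.tail x) = (∫ t, f t) * ∫ y, g y := by
  have hp := volume_preserving_piFinSuccAbove (fun _ : Fin (k + 1) => ℝ) 0
  constructor
  · exact hp.integrable_comp_of_integrable (hf.mul_prod hg)
  · rw [← integral_prod_mul]
    exact hp.integral_comp' (fun z : ℝ × (Fin k → ℝ) => f z.1 * g z.2)

theorem weight_le_head_mul_tail (k : ℕ) {u v : ℝ} (x : Fin (k + 1) → ℝ) (hu : u < x 0 ^ 2)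
    (hv : ∑ j, x j ^ 2 < v) :
    weight (k + 1) x ≤ v ^ (2 * k) * Real.exp (-u / 4) *
      (Real.exp (-(1 / 4) * x 0 ^ 2) * weight k (Fin.tail x)) := by
  obtain ⟨t, y, rfl⟩ : ∃ t y, x = Fin.cons t y := ⟨x 0, Fin.tail x, (Fin.cons_self_tail x).symm⟩
  simp only [Fin.cons_zero, Fin.tail_cons] at *
  rw [Fin.sum_univ_succ] at hv
  simp only [Fin.cons_zero, Fin.cons_succ] at hv
  have hsum : 0 ≤ ∑ j, y j ^ 2 := Finset.sum_nonneg fun j _ => sq_nonneg _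
  have hprod : (∏ j, (t ^ 2 - y j ^ 2)) ^ 2 ≤ v ^ (2 * k) := by
    rw [← Finset.prod_pow]
    calc ∏ j, (t ^ 2 - y j ^ 2) ^ 2 ≤ ∏ _j : Fin k, v ^ 2 := by
          refine Finset.prod_le_prod (fun j _ => sq_nonneg _) fun j _ => ?_
          have hj : y j ^ 2 ≤ ∑ j, y j ^ 2 :=
            Finset.single_le_sum (f := fun j => y j ^ 2) (fun j _ => sq_nonneg _)
              (Finset.mem_univ j)
          refine sq_le_sq' ?_ ?_ <;> nlinarith [sq_nonneg t, sq_nonneg (y j)]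
      _ = v ^ (2 * k) := by simp [pow_mul]
  have hexp : Real.exp (-(t ^ 2 + ∑ j, y j ^ 2) / 2) ≤
      Real.exp (-u / 4) * (Real.exp (-(1 / 4) * t ^ 2) * Real.exp (-(∑ j, y j ^ 2) / 2)) := by
    rw [← Real.exp_add, ← Real.exp_add]
    exact Real.exp_le_exp.2 (by linarith)
  rw [weight, weight, VdM_cons, Fin.sum_univ_succ, mul_pow]
  simp only [Fin.cons_zero, Fin.cons_succ]
  calc _ ≤ v ^ (2 * k) * VdM k y ^ 2 * (Real.exp (-u / 4) *
        (Real.exp (-(1 / 4) * t ^ 2) * Real.exp (-(∑ j, y j ^ 2) / 2))) := by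
        refine mul_le_mul (mul_le_mul_of_nonneg_right hprod (sq_nonneg _)) hexp
          (Real.exp_nonneg _) (mul_nonneg ?_ (sq_nonneg _))
        exact (sq_nonneg _).trans hprod
    _ = _ := by ring

theorem setIntegral_weight_large_head_le (k : ℕ) (u : ℝ) {v : ℝ} (hv : 0 ≤ v) :
    ∫ x in {x : Fin (k + 1) → ℝ | u < x 0 ^ 2 ∧ ∑ j, x j ^ 2 < v}, weight (k + 1) x ≤
      v ^ (2 * k) * Real.exp (-u / 4) * (√(4 * Real.pi) * ∫ y, weight k y) := by
  have hS : Measurable fun x : Fin (k + 1) → ℝ => ∑ j, x j ^ 2 := by fun_prop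
  have hx : Measurable fun x : Fin (k + 1) → ℝ => x 0 ^ 2 := by fun_prop
  have hB : MeasurableSet {x : Fin (k + 1) → ℝ | u < x 0 ^ 2 ∧ ∑ j, x j ^ 2 < v} :=
    (measurableSet_lt measurable_const hx).inter (measurableSet_lt hS measurable_const)
  obtain ⟨hi, he⟩ := integrable_and_integral_head_mul_tail k
    (integrable_exp_neg_mul_sq (b := 1 / 4) (by norm_num)) (integrable_weight k)
  have hi' := hi.const_mul (v ^ (2 * k) * Real.exp (-u / 4))
  refine (setIntegral_mono_on (integrable_weight (k + 1)).integrableOn hi'.integrableOn hB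
    fun x hx => weight_le_head_mul_tail k x hx.1 hx.2).trans ?_
  refine (setIntegral_le_integral hi' (Filter.Eventually.of_forall fun x => ?_)).trans_eq ?_
  · have := weight_nonneg k (Fin.tail x)
    simp only [Pi.zero_apply]
    positivity
  · rw [integral_const_mul, he, integral_gaussian]
    congr 4
    ring

theorem Zn_two_mul (k : ℕ) :
    Zn (2 * k) = √(Real.pi / 2) ^ k * ∏ j ∈ Finset.range k, ((2 * j).factorial : ℝ) := by
  rw [Zn, Nat.mul_div_cancel_left k two_pos, Real.sqrt_eq_rpow, ← Real.rpow_natCast,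
    ← Real.rpow_mul (by positivity)]
  congr 2
  push_cast
  ring

theorem Zn_two_mul_pos (k : ℕ) : 0 < Zn (2 * k) := by
  rw [Zn_two_mul]
  have : ∀ j ∈ Finset.range k, (0 : ℝ) < ((2 * j).factorial : ℝ) := fun j _ => by positivity
  have := Finset.prod_pos this
  positivity

theorem Zn_two_mul_le_succ (k : ℕ) : Zn (2 * k) ≤ Zn (2 * (k + 1)) := by
  have h1 : 1 ≤ √(Real.pi / 2) := Real.one_le_sqrt.2 (by linarith [Real.two_le_pi])
  have h2 : (1 : ℝ) ≤ ((2 * k).factorial : ℝ) := by exact_mod_cast Nat.factorial_pos _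
  have h3 : Zn (2 * (k + 1)) = Zn (2 * k) * (√(Real.pi / 2) * ((2 * k).factorial : ℝ)) := by
    rw [Zn_two_mul, Zn_two_mul, Finset.prod_range_succ, pow_succ]
    ring
  rw [h3]
  exact le_mul_of_one_le_right (Zn_two_mul_pos k).le (one_le_mul_of_one_le_of_one_le h1 h2)

theorem integral_weight_eq_Zn (k : ℕ) :
    ∫ x, weight k x = 2 ^ k * k.factorial * Zn (2 * k) := by
  have h : √(2 * Real.pi) = 2 * √(Real.pi / 2) := by
    rw [show 2 * Real.pi = 2 ^ 2 * (Real.pi / 2) by ring, Real.sqrt_mul (by positivity),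
      Real.sqrt_sq (by norm_num)]
  rw [integral_weight, Zn_two_mul, Finset.prod_mul_distrib, Finset.prod_const, Finset.card_range,
    h, mul_pow]
  ring

/-- Vectors in the open Weyl chamber with `u < ∑ x_j² < v` and all `x_j² ≤ w`. -/
def chamberShell (k : ℕ) (u v w : ℝ) : Set (Fin k → ℝ) :=
  {x | x ∈ SigmaN k ∧ (u < ∑ j, x j ^ 2 ∧ ∑ j, x j ^ 2 < v) ∧ ∀ i, x i ^ 2 ≤ w}

theorem setIntegral_shell_le_chamberShell (k : ℕ) (u : ℝ) {v : ℝ} (w : ℝ) (hv : 0 ≤ v) :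
    ∫ x in SigmaN (k + 1) ∩ {x | u < ∑ j, x j ^ 2 ∧ ∑ j, x j ^ 2 < v}, weight (k + 1) x ≤
      (∫ x in chamberShell (k + 1) u v w, weight (k + 1) x) +
        v ^ (2 * k) * Real.exp (-w / 4) * (√(4 * Real.pi) * ∫ y, weight k y) := by
  set B := {x : Fin (k + 1) → ℝ | w < x 0 ^ 2 ∧ ∑ j, x j ^ 2 < v}
  have hint := integrable_weight (k + 1)
  have hnn : ∀ s : Set (Fin (k + 1) → ℝ), 0 ≤ᵐ[volume.restrict s] weight (k + 1) := fun s =>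
    Filter.Eventually.of_forall fun x => weight_nonneg _ x
  have hsub : SigmaN (k + 1) ∩ {x | u < ∑ j, x j ^ 2 ∧ ∑ j, x j ^ 2 < v} ⊆
      chamberShell (k + 1) u v w ∪ B := by
    rintro x ⟨hx, hs⟩
    by_cases hw : ∀ i, x i ^ 2 ≤ w
    · exact Or.inl ⟨hx, hs, hw⟩
    · push Not at hw
      obtain ⟨i, hi⟩ := hw
      refine Or.inr ⟨hi.trans_le ?_, hs.2⟩
      refine pow_le_pow_left₀ (hx.2 i).le ?_ 2
      rcases (Fin.zero_le i).eq_or_lt with h | h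
      · rw [← h]
      · exact (hx.1 _ _ h).le
  have hS : Measurable fun x : Fin (k + 1) → ℝ => ∑ j, x j ^ 2 := by fun_prop
  have hx : Measurable fun x : Fin (k + 1) → ℝ => x 0 ^ 2 := by fun_prop
  have hB : MeasurableSet B :=
    (measurableSet_lt measurable_const hx).inter (measurableSet_lt hS measurable_const)
  calc _ ≤ ∫ x in chamberShell (k + 1) u v w ∪ B, weight (k + 1) x :=
        setIntegral_mono_set hint.integrableOn (hnn _) hsub.eventuallyLE
    _ ≤ (∫ x in chamberShell (k + 1) u v w, weight (k + 1) x) + ∫ x in B, weight (k + 1) x := by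
        rw [← Set.sdiff_union_self, setIntegral_union Set.disjoint_sdiff_left hB
          hint.integrableOn hint.integrableOn]
        gcongr ?_ + _
        exact setIntegral_mono_set hint.integrableOn (hnn _) Set.sdiff_subset.eventuallyLE
    _ ≤ _ := by
        gcongr
        exact setIntegral_weight_large_head_le k w hv

theorem integral_weight_le_tails_add_shell (k : ℕ) (u v : ℝ) :
    ∫ x, weight k x ≤ (∫ x in {x : Fin k → ℝ | ∑ j, x j ^ 2 ≤ u}, weight k x) +
      (∫ x in {x : Fin k → ℝ | v ≤ ∑ j, x j ^ 2}, weight k x) +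
      ∫ x in {x : Fin k → ℝ | u < ∑ j, x j ^ 2 ∧ ∑ j, x j ^ 2 < v}, weight k x := by
  have hS : Measurable fun x : Fin k → ℝ => ∑ j, x j ^ 2 := by fun_prop
  have h1 : MeasurableSet {x : Fin k → ℝ | ∑ j, x j ^ 2 ≤ u} := measurableSet_le hS measurable_const
  have h2 : MeasurableSet {x : Fin k → ℝ | v ≤ ∑ j, x j ^ 2} := measurableSet_le measurable_const hS
  have h3 : MeasurableSet {x : Fin k → ℝ | u < ∑ j, x j ^ 2 ∧ ∑ j, x j ^ 2 < v} :=
    (measurableSet_lt measurable_const hS).inter (measurableSet_lt hS measurable_const)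
  have hint := integrable_weight k
  rw [← integral_indicator h1, ← integral_indicator h2, ← integral_indicator h3,
    ← integral_add' (hint.indicator h1) (hint.indicator h2),
    ← integral_add' ((hint.indicator h1).add (hint.indicator h2)) (hint.indicator h3)]
  refine integral_mono hint (((hint.indicator h1).add (hint.indicator h2)).add
    (hint.indicator h3)) fun x => ?_
  have hw := weight_nonneg k x
  simp only [Set.indicator, Set.mem_ofPred_eq, Pi.add_apply]
  by_cases hu : ∑ j, x j ^ 2 ≤ u <;> by_cases hv : v ≤ ∑ j, x j ^ 2
  · simp [hu, hv, not_lt.2 hu, hw]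
  · simp [hu, hv, not_lt.2 hu]
  · simp [hu, hv, not_lt.2 hv]
  · simp [hu, hv, not_le.1 hu, not_le.1 hv]

/-- Quantitative lower bound for the normalized mass of `chamberShell`. -/
theorem le_inv_Zn_mul_setIntegral_chamberShell (k : ℕ) {a b δ N : ℝ} (ha : 0 < a) (ha1 : a < 1)
    (hb : 1 < b) (hN : N = (k + 1 : ℕ) * (2 * (k + 1 : ℕ) - 1)) :
    1 - Real.exp (-(N / 2 * (a - 1 - Real.log a))) - Real.exp (-(N / 2 * (b - 1 - Real.log b))) -
      (b * N) ^ (2 * k) * Real.exp (-(δ * N) / 4) * (√(4 * Real.pi) * (2 ^ k * k.factorial)) ≤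
    (Zn (2 * (k + 1)))⁻¹ *
      ∫ x in chamberShell (k + 1) (a * N) (b * N) (δ * N), weight (k + 1) x := by
  have hS : Measurable fun x : Fin (k + 1) → ℝ => ∑ j, x j ^ 2 := by fun_prop
  have hZ := Zn_two_mul_pos (k + 1)
  have hN0 : 0 ≤ N := by
    rw [hN]; push_cast
    have : (0 : ℝ) ≤ k := Nat.cast_nonneg k
    exact mul_nonneg (by linarith) (by linarith)
  have hA := setIntegral_weight_chernoff (k + 1) ha (measurableSet_le hS measurable_const)
    (A := {x | ∑ j, x j ^ 2 ≤ a * N}) fun x hx => by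
      rw [← hN]
      exact mul_le_mul_of_nonpos_left hx (by linarith [(one_lt_inv₀ ha).2 ha1])
  have hB := setIntegral_weight_chernoff (k + 1) (zero_lt_one.trans hb)
    (measurableSet_le measurable_const hS)
    (A := {x | b * N ≤ ∑ j, x j ^ 2}) fun x hx => by
      rw [← hN]
      exact mul_le_mul_of_nonneg_left hx (by linarith [inv_lt_one_of_one_lt₀ hb])
  rw [← hN] at hA hB
  have hT := integral_weight_le_tails_add_shell (k + 1) (a * N) (b * N)
  have hG := setIntegral_shell_le (k + 1) (a * N) (b * N)
  have hD := setIntegral_shell_le_chamberShell k (a * N) (δ * N)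
    (mul_nonneg (zero_le_one.trans hb.le) hN0)
  rw [integral_weight_eq_Zn] at hA hB hT hD
  set Z := Zn (2 * (k + 1))
  set M : ℝ := 2 ^ (k + 1) * (k + 1).factorial with hM
  have hMpos : 0 < M := by positivity
  set P := ∫ x in SigmaN (k + 1) ∩ {x | a * N < ∑ j, x j ^ 2 ∧ ∑ j, x j ^ 2 < b * N},
    weight (k + 1) x
  set eA := Real.exp (-(N / 2 * (a - 1 - Real.log a)))
  set eB := Real.exp (-(N / 2 * (b - 1 - Real.log b)))
  have hP : Z * (1 - eA - eB) ≤ P := by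
    refine le_of_mul_le_mul_left ?_ hMpos
    linarith
  have hE : (b * N) ^ (2 * k) * Real.exp (-(δ * N) / 4) *
      (√(4 * Real.pi) * (2 ^ k * k.factorial * Zn (2 * k))) ≤
      (b * N) ^ (2 * k) * Real.exp (-(δ * N) / 4) * (√(4 * Real.pi) * (2 ^ k * k.factorial)) * Z := by
    have hb0 : 0 ≤ b * N := mul_nonneg (zero_le_one.trans hb.le) hN0
    have := Zn_two_mul_le_succ k
    rw [mul_assoc _ _ Z, mul_assoc _ _ Z]
    gcongr
  rw [inv_mul_eq_div, le_div_iff₀ hZ]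
  linarith

theorem eventually_error_le {b δ : ℝ} (hb : 1 < b) (hδ : 0 < δ) :
    ∀ᶠ k : ℕ in Filter.atTop, ∀ N : ℝ, N = (k + 1 : ℕ) * (2 * (k + 1 : ℕ) - 1) →
      (b * N) ^ (2 * k) * Real.exp (-(δ * N) / 4) * (√(4 * Real.pi) * (2 ^ k * k.factorial))
        ≤ 1 / 4 := by
  have hb0 : 0 < b := zero_lt_one.trans hb
  have ht : Filter.Tendsto (fun m : ℕ => 32 * b ^ 2 * ((m : ℝ) ^ 5 * Real.exp (-(δ / 4) * m)))
      Filter.atTop (nhds 0) := by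
    have h1 := (tendsto_rpow_mul_exp_neg_mul_atTop_nhds_zero 5 (δ / 4) (by positivity)).comp
      (tendsto_natCast_atTop_atTop (R := ℝ))
    have h2 := h1.const_mul (32 * b ^ 2)
    rw [mul_zero] at h2
    refine h2.congr fun m => ?_
    simp only [Function.comp]
    norm_cast
  have hev := (Filter.tendsto_add_atTop_nat 1).eventually
    (ht.eventually (ge_mem_nhds (show (0 : ℝ) < 1 / 4 by norm_num)))
  filter_upwards [hev] with k hk N hN
  set m : ℕ := k + 1 with hm
  have hm1 : (1 : ℝ) ≤ m := by simp [hm]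
  have hNle : N ≤ 2 * (m : ℝ) ^ 2 := by rw [hN]; nlinarith
  have hNge : (m : ℝ) * m ≤ N := by rw [hN]; nlinarith
  have hN0 : 0 ≤ N := le_trans (by positivity) hNge
  have hbase : 1 ≤ b * (2 * (m : ℝ) ^ 2) := by nlinarith [mul_self_nonneg ((m : ℝ) - 1)]
  have hfac : (k.factorial : ℝ) ≤ (m : ℝ) ^ m := by
    have h1 : k.factorial ≤ m ^ m := (Nat.factorial_le (Nat.le_succ k)).trans (Nat.factorial_le_pow m)
    exact_mod_cast h1
  have hpi : √(4 * Real.pi) ≤ 4 ^ m := by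
    have h4 : √(4 * Real.pi) ≤ 4 := Real.sqrt_le_iff.2 ⟨by norm_num, by linarith [Real.pi_le_four]⟩
    exact h4.trans (le_self_pow₀ (by norm_num) (Nat.succ_ne_zero k))
  have hpow : (b * N) ^ (2 * k) ≤ (b * (2 * (m : ℝ) ^ 2)) ^ (2 * m) := by
    calc (b * N) ^ (2 * k) ≤ (b * (2 * (m : ℝ) ^ 2)) ^ (2 * k) := by gcongr
      _ ≤ _ := pow_le_pow_right₀ hbase (by omega)
  have hexp : Real.exp (-(δ * N) / 4) ≤ Real.exp (-(δ / 4) * m) ^ m := by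
    rw [← Real.exp_nat_mul]
    exact Real.exp_le_exp.2 (by nlinarith)
  calc _ ≤ (b * (2 * (m : ℝ) ^ 2)) ^ (2 * m) * Real.exp (-(δ / 4) * m) ^ m *
        (4 ^ m * (2 ^ m * (m : ℝ) ^ m)) := by
        gcongr
        · norm_num
        · omega
    _ = (32 * b ^ 2 * ((m : ℝ) ^ 5 * Real.exp (-(δ / 4) * m))) ^ m := by
        rw [pow_mul, ← mul_pow, ← mul_pow, ← mul_pow, ← mul_pow]
        congr 1
        ring
    _ ≤ 32 * b ^ 2 * ((m : ℝ) ^ 5 * Real.exp (-(δ / 4) * m)) :=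
        pow_le_of_le_one (by positivity) (hk.trans (by norm_num)) (Nat.succ_ne_zero k)
    _ ≤ 1 / 4 := hk

theorem eventually_exp_tail_le {c : ℝ} (hc : 0 < c) (hc1 : c ≠ 1) :
    ∀ᶠ k : ℕ in Filter.atTop, ∀ N : ℝ, N = (k + 1 : ℕ) * (2 * (k + 1 : ℕ) - 1) →
      Real.exp (-(N / 2 * (c - 1 - Real.log c))) ≤ 1 / 4 := by
  have hpos : 0 < c - 1 - Real.log c := by linarith [Real.log_lt_sub_one_of_pos hc hc1]
  have ht : Filter.Tendsto (fun k : ℕ => Real.exp (-((k : ℝ) / 2 * (c - 1 - Real.log c))))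
      Filter.atTop (nhds 0) :=
    Real.tendsto_exp_neg_atTop_nhds_zero.comp
      ((tendsto_natCast_atTop_atTop.atTop_div_const two_pos).atTop_mul_const hpos)
  filter_upwards [ht.eventually (ge_mem_nhds (show (0 : ℝ) < 1 / 4 by norm_num))] with k hk N hN
  refine le_trans (Real.exp_le_exp.2 (neg_le_neg ?_)) hk
  have hk0 : (0 : ℝ) ≤ k := Nat.cast_nonneg k
  have : (k : ℝ) ≤ N := by rw [hN]; push_cast; nlinarith
  gcongr

theorem eventually_le_integral_SigABD {a b δ : ℝ} (ha : 0 < a) (ha1 : a < 1) (hb : 1 < b)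
    (hδ : 0 < δ) :
    ∀ᶠ m : ℕ in Filter.atTop, 1 / 4 ≤ ∫ μ in SigABD (2 * m) a b δ,
      (Zn (2 * m))⁻¹ * (VdM ((2 * m) / 2) μ) ^ 2 * Real.exp (-(∑ j, μ j ^ 2) / 2) := by
  rw [← Filter.map_add_atTop_eq_nat 1, Filter.eventually_map]
  filter_upwards [eventually_exp_tail_le ha ha1.ne,
    eventually_exp_tail_le (zero_lt_one.trans hb) hb.ne', eventually_error_le hb hδ]
    with k h1 h2 h3
  have hN : (((2 * (k + 1)).choose 2 : ℕ) : ℝ) = (k + 1 : ℕ) * (2 * (k + 1 : ℕ) - 1) := by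
    rw [Nat.cast_choose_two]
    push_cast
    ring
  have hmain := le_inv_Zn_mul_setIntegral_chamberShell k (δ := δ) ha ha1 hb hN
  have hcast : ∀ j, j = k + 1 → ∀ u v w : ℝ, ∫ μ in chamberShell j u v w,
      (Zn (2 * (k + 1)))⁻¹ * VdM j μ ^ 2 * Real.exp (-(∑ i, μ i ^ 2) / 2) =
      (Zn (2 * (k + 1)))⁻¹ * ∫ x in chamberShell (k + 1) u v w, weight (k + 1) x := by
    rintro _ rfl u v w
    simp_rw [weight, ← integral_const_mul, mul_assoc]
  refine le_of_le_of_eq ?_ (hcast (2 * (k + 1) / 2) (Nat.mul_div_cancel_left _ two_pos) _ _ _).symm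
  linarith [h1 _ hN, h2 _ hN, h3 _ hN]

theorem stmt8 (a b δ : ℝ) (ha : 0 < a) (ha1 : a < 1) (hb : 1 < b) (hδ : 0 < δ) :
    (0 : EReal) ≤ Filter.liminf (fun m : ℕ =>
      (((1 / (2 * m : ℝ) ^ 2) * Real.log (∫ μ in SigABD (2 * m) a b δ,
          (Zn (2 * m))⁻¹ * (VdM ((2 * m) / 2) μ) ^ 2
            * Real.exp (-(∑ j, μ j ^ 2) / 2)) : ℝ) : EReal))
      Filter.atTop := by
  have hlim : Filter.Tendsto (fun m : ℕ => (((1 / (2 * m : ℝ) ^ 2) * Real.log (1 / 4) : ℝ) : EReal))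
      Filter.atTop (nhds 0) := by
    have h1 : Filter.Tendsto (fun m : ℕ => (2 * m : ℝ) ^ 2) Filter.atTop Filter.atTop :=
      (Filter.tendsto_pow_atTop two_ne_zero).comp
        (tendsto_natCast_atTop_atTop.const_mul_atTop two_pos)
    have h2 := (h1.inv_tendsto_atTop).mul_const (Real.log (1 / 4))
    rw [zero_mul] at h2
    refine ((continuous_coe_real_ereal.tendsto 0).comp h2).congr fun m => ?_
    simp
  rw [← hlim.liminf_eq]
  refine Filter.liminf_le_liminf ?_
  filter_upwards [eventually_le_integral_SigABD ha ha1 hb hδ] with m hm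
  exact EReal.coe_le_coe_iff.2 (mul_le_mul_of_nonneg_left
    (Real.log_le_log (by norm_num) hm) (by positivity))
end
end

section
/- Let x = (x_j)_{j=0}^∞ ∈ X, let ε ∈ (0,1), let k ≥ 1 be an integer with Σ_{j=k+1}^∞ x_j² < ε²/2, let δ ∈ (0,ε) satisfy √k · δ < √(x_0 + ε/2) − √(x_0), and set a = x_0 − Σ_{j=1}^∞ x_j² ≥ 0. If y = (y_j)_{j=0}^∞ ∈ X_0 (i.e. y ∈ X with y_0 = Σ_{j=1}^∞ y_j²) satisfies x_j < y_j < x_j + δ for all 1 ≤ j ≤ k, y_{k+1} < ε, and a < Σ_{j=k+1}^∞ y_j² < a + ε/2, then d(x,y) < ε. -/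
open MeasureTheory BoundedContinuousFunction Filter

noncomputable section

/-- Membership in the space `X ⊆ l^∞`: `x_j ≥ x_{j+1} ≥ 0` for `j ≥ 1` and
`Σ_{j=1}^∞ x_j² ≤ x_0` (the series being summable). Bounded sequences are modeled as
bounded (continuous) functions `ℕ →ᵇ ℝ`, whose distance is the sup metric `d`. -/
def memX (x : ℕ →ᵇ ℝ) : Prop :=
  (∀ j : ℕ, 1 ≤ j → 0 ≤ x (j + 1) ∧ x (j + 1) ≤ x j) ∧
  Summable (fun j : ℕ => (x (j + 1)) ^ 2) ∧ (∑' j : ℕ, (x (j + 1)) ^ 2) ≤ x 0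

def setX : Set (ℕ →ᵇ ℝ) := {x | memX x}

/-- `J(x) = x_0 − Σ_{j=1}^∞ x_j²`. -/
def Jfun (x : ℕ →ᵇ ℝ) : ℝ := x 0 - ∑' j : ℕ, (x (j + 1)) ^ 2

/-- The rate function `I(x) = x_0 − 1 − ln J(x)` for `J(x) > 0`, and `+∞` when `J(x) = 0`. -/
def Ifun (x : ℕ →ᵇ ℝ) : EReal :=
  if 0 < Jfun x then ((x 0 - 1 - Real.log (Jfun x) : ℝ) : EReal) else ⊤

/-- Past any positive index, the terms of a sequence in `X` lie between `0` and the term there. -/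
lemma memX.nonneg_and_le {x : ℕ →ᵇ ℝ} (hx : memX x) {k : ℕ} (hk : 1 ≤ k) (i : ℕ) :
    0 ≤ x (k + 1 + i) ∧ x (k + 1 + i) ≤ x (k + 1) := by
  induction i with
  | zero => exact ⟨(hx.1 k hk).1, le_rfl⟩
  | succ i ih =>
    obtain ⟨h0, h1⟩ := hx.1 (k + 1 + i) (by omega)
    exact ⟨h0, h1.trans ih.2⟩

lemma memX.summable_tail {x : ℕ →ᵇ ℝ} (hx : memX x) (k : ℕ) :
    Summable (fun j : ℕ => (x (j + (k + 1))) ^ 2) :=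
  (summable_nat_add_iff (f := fun j : ℕ => (x (j + 1)) ^ 2) k).2 hx.2.1

lemma memX.sum_add_tail {x : ℕ →ᵇ ℝ} (hx : memX x) (k : ℕ) :
    ∑ i ∈ Finset.range k, (x (i + 1)) ^ 2 + ∑' j : ℕ, (x (j + (k + 1))) ^ 2
      = ∑' j : ℕ, (x (j + 1)) ^ 2 :=
  hx.2.1.sum_add_tsum_nat_add k

/-- Minkowski's inequality for the shift of a finite sequence by a constant. -/
lemma sum_add_const_sq_le (u : ℕ → ℝ) (k : ℕ) {δ M : ℝ} (hδ : 0 ≤ δ)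
    (hM : ∑ i ∈ Finset.range k, u i ^ 2 ≤ M) :
    ∑ i ∈ Finset.range k, (u i + δ) ^ 2 - ∑ i ∈ Finset.range k, u i ^ 2
      ≤ (√M + √k * δ) ^ 2 - M := by
  have hM0 : 0 ≤ M := (Finset.sum_nonneg fun i _ => sq_nonneg (u i)).trans hM
  have hcs : ∑ i ∈ Finset.range k, u i ≤ √k * √M := by
    rw [← Real.sqrt_mul k.cast_nonneg]
    apply Real.le_sqrt_of_sq_le
    have := sq_sum_le_card_mul_sum_sq (s := Finset.range k) (f := u)
    rw [Finset.card_range] at this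
    exact this.trans (mul_le_mul_of_nonneg_left hM k.cast_nonneg)
  have hexp : ∑ i ∈ Finset.range k, (u i + δ) ^ 2
      = ∑ i ∈ Finset.range k, u i ^ 2 + 2 * δ * ∑ i ∈ Finset.range k, u i + k * δ ^ 2 := by
    simp only [add_sq, Finset.sum_add_distrib, Finset.mul_sum, Finset.sum_const,
      Finset.card_range, nsmul_eq_mul]
    congr 2
    exact Finset.sum_congr rfl fun i _ => by ring
  have hrhs : (√M + √k * δ) ^ 2 - M = 2 * δ * (√k * √M) + k * δ ^ 2 := by
    rw [add_sq, mul_pow, Real.sq_sqrt hM0, Real.sq_sqrt k.cast_nonneg]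
    ring
  rw [hexp, hrhs]
  linarith [mul_le_mul_of_nonneg_left hcs (mul_nonneg zero_le_two hδ)]

theorem stmt11 (x y : ℕ →ᵇ ℝ) (hx : memX x) (hy : memX y)
    (hy0 : (∑' j : ℕ, (y (j + 1)) ^ 2) = y 0)
    (ε : ℝ) (hε0 : 0 < ε) (hε1 : ε < 1)
    (k : ℕ) (hk : 1 ≤ k)
    (htail : (∑' j : ℕ, (x (j + (k + 1))) ^ 2) < ε ^ 2 / 2)
    (δ : ℝ) (hδ0 : 0 < δ) (hδε : δ < ε)
    (hδk : Real.sqrt k * δ < Real.sqrt (x 0 + ε / 2) - Real.sqrt (x 0))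
    (a : ℝ) (ha : a = x 0 - ∑' j : ℕ, (x (j + 1)) ^ 2)
    (h1 : ∀ j : ℕ, 1 ≤ j → j ≤ k → x j < y j ∧ y j < x j + δ)
    (h2 : y (k + 1) < ε)
    (h3 : a < ∑' j : ℕ, (y (j + (k + 1))) ^ 2)
    (h4 : (∑' j : ℕ, (y (j + (k + 1))) ^ 2) < a + ε / 2) :
    dist x y < ε := by
  have hsx := hx.sum_add_tail k
  have hsy := hy.sum_add_tail k
  have hxnn : ∀ i, 0 ≤ x (i + 1 + 1) := fun i => (hx.1 (i + 1) (by omega)).1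
  have hx1 : ∀ i, 0 ≤ x (i + 1) := fun i => (hxnn i).trans (hx.1 (i + 1) (by omega)).2
  have htail0 : 0 ≤ ∑' j : ℕ, (x (j + (k + 1))) ^ 2 := tsum_nonneg fun j => sq_nonneg _
  have hx0 : 0 ≤ x 0 := (tsum_nonneg fun j => sq_nonneg _).trans hx.2.2
  have hhead : ∀ i ∈ Finset.range k, x (i + 1) < y (i + 1) ∧ y (i + 1) < x (i + 1) + δ :=
    fun i hi => h1 (i + 1) (by omega) (by have := Finset.mem_range.1 hi; omega)
  have hlow : ∑ i ∈ Finset.range k, (x (i + 1)) ^ 2 ≤ ∑ i ∈ Finset.range k, (y (i + 1)) ^ 2 :=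
    Finset.sum_le_sum fun i hi => pow_le_pow_left₀ (hx1 i) (hhead i hi).1.le 2
  have hup : ∑ i ∈ Finset.range k, (y (i + 1)) ^ 2
      ≤ ∑ i ∈ Finset.range k, (x (i + 1) + δ) ^ 2 :=
    Finset.sum_le_sum fun i hi =>
      pow_le_pow_left₀ ((hx1 i).trans (hhead i hi).1.le) (hhead i hi).2.le 2
  have hmink := sum_add_const_sq_le (fun i => x (i + 1)) k (M := x 0) hδ0.le
    (by linarith [hx.2.2])
  have hsq : (√(x 0) + √k * δ) ^ 2 < x 0 + ε / 2 := by
    rw [← Real.lt_sqrt (by positivity)]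
    linarith
  have hεsq : ε ^ 2 < ε := by nlinarith
  have hzero : |x 0 - y 0| < ε := by
    rw [abs_lt]
    constructor <;> linarith
  have hxk : x (k + 1) < ε := by
    have hle := (hx.summable_tail k).le_tsum 0 fun j _ => sq_nonneg _
    simp only [zero_add] at hle
    refine lt_of_pow_lt_pow_left₀ 2 hε0.le ?_
    linarith [sq_nonneg ε]
  have hle : dist x y ≤ max (max |x 0 - y 0| δ) (max (x (k + 1)) (y (k + 1))) := by
    refine (dist_le (le_max_of_le_left (le_max_of_le_right hδ0.le))).2 fun j => ?_
    rw [Real.dist_eq]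
    rcases Nat.eq_zero_or_pos j with rfl | hj
    · exact le_max_of_le_left (le_max_left _ _)
    rcases le_or_gt j k with hjk | hjk
    · obtain ⟨hlt, hgt⟩ := h1 j hj hjk
      exact le_max_of_le_left (le_max_of_le_right (abs_le.2 ⟨by linarith, by linarith⟩))
    · obtain ⟨i, rfl⟩ := Nat.exists_eq_add_of_le (Nat.succ_le_of_lt hjk)
      obtain ⟨hxi, hxi'⟩ := hx.nonneg_and_le hk i
      obtain ⟨hyi, hyi'⟩ := hy.nonneg_and_le hk i
      refine le_max_of_le_right (abs_sub_le_iff.2 ⟨le_max_of_le_left ?_, le_max_of_le_right ?_⟩) <;>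
        grind
  exact hle.trans_lt (max_lt (max_lt hzero hδε) (max_lt hxk h2))
end
end
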